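/- Assume ∫(μ1 + π0·δlow) dP > 0. Let 𝒰 be the set of monotone non-decreasing functions u : ℝ → [0,1], and let Δᴹ = { δ : δ(x) = δlow(x) + (δhigh(x) − δlow(x))·u(β0(x)) for some u ∈ 𝒰 } ⊆ Δ. Then the supremum over δ ∈ Δ of perf₊(δ) = ∫(β0·μ1 + β0·π0·δ) dP / ∫(μ1 + π0·δ) dP equals the supremum over δ ∈ Δᴹ of perf₊(δ); that is, optimization over all confounding functions consistent with the bounds reduces to optimization over monotone reparametrizations of β0. -/

import Mathlib

open MeasureTheory

/-- A bounded measurable function on a finite measure space is integrable. -/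
lemma integrable_of_measurable_of_abs_le {𝒳 : Type*} [MeasurableSpace 𝒳] {P : Measure 𝒳}
    [IsFiniteMeasure P] {f : 𝒳 → ℝ} (hf : Measurable f) (hb : ∃ C, ∀ x, |f x| ≤ C) :
    Integrable f P := by
  obtain ⟨C, hC⟩ := hb
  exact Integrable.of_bound hf.aestronglyMeasurable C (.of_forall hC)

/-- Products of functions bounded in absolute value are bounded in absolute value. -/
lemma exists_abs_mul_le {𝒳 : Type*} {f g : 𝒳 → ℝ} (hf : ∃ C, ∀ x, |f x| ≤ C)
    (hg : ∃ C, ∀ x, |g x| ≤ C) : ∃ C, ∀ x, |f x * g x| ≤ C := by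
  obtain ⟨A, hA⟩ := hf
  obtain ⟨B, hB⟩ := hg
  refine ⟨A * B, fun x => ?_⟩
  rw [abs_mul]
  exact mul_le_mul (hA x) (hB x) (abs_nonneg _) ((abs_nonneg _).trans (hA x))

/-- Functions lying between two bounded functions are bounded. -/
lemma exists_abs_le_of_between {𝒳 : Type*} {f g h : 𝒳 → ℝ} (hf : ∃ C, ∀ x, |f x| ≤ C)
    (hg : ∃ C, ∀ x, |g x| ≤ C) (hh : ∀ x, f x ≤ h x ∧ h x ≤ g x) :
    ∃ C, ∀ x, |h x| ≤ C := by
  obtain ⟨A, hA⟩ := hf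
  obtain ⟨B, hB⟩ := hg
  exact ⟨max A B, fun x => (abs_le_max_abs_abs (hh x).1 (hh x).2).trans
    (max_le_max (hA x) (hB x))⟩

/-- Moving from `a` towards `b` by a fraction `v ∈ [0, 1]` stays between `a` and `b`. -/
lemma le_add_sub_mul_and_le {a b v : ℝ} (hab : a ≤ b) (hv : 0 ≤ v ∧ v ≤ 1) :
    a ≤ a + (b - a) * v ∧ a + (b - a) * v ≤ b := by
  constructor <;> nlinarith [mul_nonneg (sub_nonneg.2 hab) hv.1,
    mul_nonneg (sub_nonneg.2 hab) (sub_nonneg.2 hv.2)]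

/-- The indicator of `t > r` picks the point of `[a, b]` that maximizes `d ↦ (t - r) * d`. -/
lemma sub_mul_le_threshold {a b d t r : ℝ} (hd : a ≤ d ∧ d ≤ b) :
    (t - r) * d ≤ (t - r) * (a + (b - a) * if r < t then 1 else 0) := by
  split_ifs with h
  · nlinarith
  · nlinarith

/-- Reduction to monotone reparametrizations: the supremum of the positive class
performance over all confounding functions `δ` with `δlow ≤ δ ≤ δhigh` equals the
supremum over confounding functions of the form
`δ(x) = δlow(x) + (δhigh(x) - δlow(x)) u(β0(x))` for monotone non-decreasing
`u : ℝ → [0,1]`. -/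
theorem positive_class_sup_reduction_to_monotone
    {𝒳 : Type*} [MeasurableSpace 𝒳] (P : Measure 𝒳) [IsProbabilityMeasure P]
    (μ1 π0 δlow δhigh β0 : 𝒳 → ℝ)
    (hμ1m : Measurable μ1) (hπ0m : Measurable π0)
    (hδlm : Measurable δlow) (hδhm : Measurable δhigh)
    (hβ0m : Measurable β0)
    (hμ1b : ∃ C, ∀ x, |μ1 x| ≤ C) (hπ0b : ∃ C, ∀ x, |π0 x| ≤ C)
    (hδlb : ∃ C, ∀ x, |δlow x| ≤ C) (hδhb : ∃ C, ∀ x, |δhigh x| ≤ C)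
    (hβ0b : ∃ C, ∀ x, |β0 x| ≤ C)
    (hπ0 : ∀ x, 0 ≤ π0 x) (hδ : ∀ x, δlow x ≤ δhigh x)
    (hden : 0 < ∫ x, μ1 x + π0 x * δlow x ∂P) :
    sSup {r : ℝ | ∃ δ : 𝒳 → ℝ, Measurable δ ∧ (∀ x, δlow x ≤ δ x ∧ δ x ≤ δhigh x) ∧
        r = (∫ x, β0 x * μ1 x + β0 x * π0 x * δ x ∂P) /
              (∫ x, μ1 x + π0 x * δ x ∂P)} =
    sSup {r : ℝ | ∃ u : ℝ → ℝ, Monotone u ∧ (∀ t, 0 ≤ u t ∧ u t ≤ 1) ∧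
        r = (∫ x, β0 x * μ1 x +
                β0 x * π0 x * (δlow x + (δhigh x - δlow x) * u (β0 x)) ∂P) /
            (∫ x, μ1 x + π0 x * (δlow x + (δhigh x - δlow x) * u (β0 x)) ∂P)} := by
  have hint_den : ∀ δ : 𝒳 → ℝ, Measurable δ → (∀ x, δlow x ≤ δ x ∧ δ x ≤ δhigh x) →
      Integrable (fun x => μ1 x + π0 x * δ x) P := fun δ hm hb =>
    (integrable_of_measurable_of_abs_le hμ1m hμ1b).add
      (integrable_of_measurable_of_abs_le (hπ0m.mul hm)
        (exists_abs_mul_le hπ0b (exists_abs_le_of_between hδlb hδhb hb)))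
  have hint_num : ∀ δ : 𝒳 → ℝ, Measurable δ → (∀ x, δlow x ≤ δ x ∧ δ x ≤ δhigh x) →
      Integrable (fun x => β0 x * μ1 x + β0 x * π0 x * δ x) P := fun δ hm hb =>
    (integrable_of_measurable_of_abs_le (hβ0m.mul hμ1m) (exists_abs_mul_le hβ0b hμ1b)).add
      (integrable_of_measurable_of_abs_le ((hβ0m.mul hπ0m).mul hm)
        (exists_abs_mul_le (exists_abs_mul_le hβ0b hπ0b)
          (exists_abs_le_of_between hδlb hδhb hb)))
  have hpos : ∀ δ : 𝒳 → ℝ, Measurable δ → (∀ x, δlow x ≤ δ x ∧ δ x ≤ δhigh x) →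
      0 < ∫ x, μ1 x + π0 x * δ x ∂P := fun δ hm hb =>
    hden.trans_le <| integral_mono (hint_den δlow hδlm fun x => ⟨le_rfl, hδ x⟩)
      (hint_den δ hm hb) fun x =>
        add_le_add_right (mul_le_mul_of_nonneg_left (hb x).1 (hπ0 x)) _
  have hmeas : ∀ u : ℝ → ℝ, Monotone u →
      Measurable fun x => δlow x + (δhigh x - δlow x) * u (β0 x) := fun u hu =>
    hδlm.add ((hδhm.sub hδlm).mul (hu.measurable.comp hβ0m))
  have hbd : ∀ u : ℝ → ℝ, (∀ t, 0 ≤ u t ∧ u t ≤ 1) → ∀ x,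
      δlow x ≤ δlow x + (δhigh x - δlow x) * u (β0 x) ∧
        δlow x + (δhigh x - δlow x) * u (β0 x) ≤ δhigh x := fun u hu x =>
    le_add_sub_mul_and_le (hδ x) (hu _)
  apply csSup_eq_csSup_of_forall_exists_le
  · rintro r ⟨δ, hm, hb, hr⟩
    let u : ℝ → ℝ := fun t => if r < t then 1 else 0
    have hu : Monotone u := by
      intro s t hst
      dsimp only [u]
      split_ifs <;> linarith
    have hu01 : ∀ t, 0 ≤ u t ∧ u t ≤ 1 := by
      intro t
      dsimp only [u]
      split_ifs <;> norm_num
    refine ⟨_, ⟨u, hu, hu01, rfl⟩, ?_⟩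
    have hm' := hmeas u hu
    have hb' := hbd u hu01
    rw [le_div_iff₀ (hpos _ hm' hb')]
    rw [eq_div_iff (hpos δ hm hb).ne'] at hr
    have key := integral_mono
      ((hint_num δ hm hb).sub ((hint_den δ hm hb).const_mul r))
      ((hint_num _ hm' hb').sub ((hint_den _ hm' hb').const_mul r)) fun x => by
        have h := mul_le_mul_of_nonneg_left
          (sub_mul_le_threshold (t := β0 x) (r := r) (hb x)) (hπ0 x)
        simp only [Pi.sub_apply, u]
        linarith
    simp only [Pi.sub_apply] at key
    rw [integral_sub (hint_num δ hm hb) ((hint_den δ hm hb).const_mul r),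
      integral_sub (hint_num _ hm' hb') ((hint_den _ hm' hb').const_mul r),
      integral_const_mul, integral_const_mul] at key
    linarith
  · rintro r ⟨u, hu, hu01, hr⟩
    exact ⟨r, ⟨_, hmeas u hu, hbd u hu01, hr⟩, le_rfl⟩
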